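/- Suppose η is conditionally independent of X given B^T X for a matrix B ∈ R^{p×q}, and the linearity condition E[X | B^T X] = P_B(Σ)^T X holds, where Σ = Var(X) and P_B(Σ) = B (B^T Σ B)^{-1} B^T Σ. Then for every t ∈ R, the vector m(t) = E[X e^{itη}] lies in the column span of Σ B, and hence the column span of M = ∫ m(t) m(t)^H dF_η(t) is contained in Σ · Span(B). -/

import Mathlib

open MeasureTheory ProbabilityTheory

lemma stmt2_key {Ω : Type*} (G : MeasurableSpace Ω) [mΩ : MeasurableSpace Ω] [StandardBorelSpace Ω] [Nonempty Ω]
    (μ : Measure Ω) [IsProbabilityMeasure μ] (hG : G ≤ mΩ)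
    (Y : Ω → ℝ) (e : Ω → ℂ) (hY : Measurable Y) (he : Measurable e)
    (hYi : Integrable Y μ) (hb : ∀ ω, ‖e ω‖ ≤ 1) (hCI : CondIndepFun G hG Y e μ) :
    ∫ ω, Y ω • e ω ∂μ = ∫ ω, (μ[Y | G]) ω • e ω ∂μ := by
  have hei : Integrable e μ :=
    Integrable.of_bound he.aestronglyMeasurable 1 (Filter.Eventually.of_forall hb)
  have hYe : Integrable (fun ω => Y ω • e ω) μ := by
    refine hYi.norm.mono' (by fun_prop) (Filter.Eventually.of_forall fun ω => ?_)
    rw [norm_smul]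
    exact mul_le_of_le_one_right (norm_nonneg _) (hb ω)
  have hZe : Integrable (fun ω => (μ[Y | G]) ω • e ω) μ := by
    have hc : Integrable (μ[Y | G]) μ := integrable_condExp
    refine hc.norm.mono' (hc.aestronglyMeasurable.smul hei.aestronglyMeasurable)
      (Filter.Eventually.of_forall fun ω => ?_)
    rw [norm_smul]
    exact mul_le_of_le_one_right (norm_nonneg _) (hb ω)
  rw [← integral_condExp hG (f := fun ω => Y ω • e ω),
    ← integral_condExp hG (f := fun ω => (μ[Y | G]) ω • e ω)]
  refine integral_congr_ae ?_
  have h1 := condExp_ae_eq_integral_condExpKernel hG hYe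
  have h2 := condExp_ae_eq_integral_condExpKernel hG hYi
  have h3 := condExp_ae_eq_integral_condExpKernel hG hei
  have h4 : μ[(fun ω => (μ[Y | G]) ω • e ω) | G] =ᵐ[μ] fun ω => (μ[Y | G]) ω • (μ[e | G]) ω :=
    condExp_bilin_of_aestronglyMeasurable_left (.lsmul ℝ ℝ)
      stronglyMeasurable_condExp.aestronglyMeasurable hZe hei
  have h5 := ae_of_ae_trim hG ((condIndepFun_iff_map_prod_eq_prod_map_map hY he).1 hCI)
  filter_upwards [h1, h2, h3, h4, h5] with ω h1 h2 h3 h4 h5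
  rw [h1, h4, h2, h3]
  rw [Kernel.map_apply _ (by fun_prop), Kernel.prod_apply, Kernel.map_apply _ hY,
    Kernel.map_apply _ he] at h5
  have hI : IndepFun Y e (condExpKernel μ G ω) :=
    (indepFun_iff_map_prod_eq_prod_map_map hY.aemeasurable he.aemeasurable).2 h5
  exact hI.integral_fun_smul_eq_smul_integral hY.aestronglyMeasurable he.aestronglyMeasurable

lemma stmt2_span {p q : ℕ} (A : Matrix (Fin p) (Fin q) ℝ) (C : Matrix (Fin q) (Fin p) ℝ)
    (v : Fin p → ℂ) (hv : ∀ i, v i = ∑ k, ((A * C) i k : ℂ) * v k) :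
    v ∈ Submodule.span ℂ (Set.range fun k : Fin q => fun i : Fin p => (A i k : ℂ)) := by
  rw [Submodule.mem_span_range_iff_exists_fun]
  refine ⟨fun k => ∑ l, (C k l : ℂ) * v l, ?_⟩
  ext i
  rw [hv i]
  simp only [Finset.sum_apply, Pi.smul_apply, smul_eq_mul, Matrix.mul_apply, Complex.ofReal_sum,
    Complex.ofReal_mul, Finset.sum_mul]
  rw [Finset.sum_comm]
  refine Finset.sum_congr rfl fun k _ => Finset.sum_congr rfl fun l _ => ?_
  ring

/-- Under conditional independence of `η` and `X` given `Bᵀ X` and the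
linearity condition `E[X | BᵀX] = P_B(Σ)ᵀ X`, every vector `m t = E[X e^{itη}]` lies in
the column span of `Σ B`, and hence the column span of `M = ∫ m m^H dF_η` is contained
in `Σ · Span(B)`. -/
theorem stmt2 {Ω : Type*} [mΩ : MeasurableSpace Ω] [StandardBorelSpace Ω] [Nonempty Ω]
    (μ : Measure Ω) [IsProbabilityMeasure μ]
    {p q : ℕ} (X : Ω → Fin p → ℝ) (η : Ω → ℝ)
    (hXm : Measurable X) (hηm : Measurable η)
    (hEX : ∀ i, (∫ ω, X ω i ∂μ) = 0)
    (B : Matrix (Fin p) (Fin q) ℝ) (Sig : Matrix (Fin p) (Fin p) ℝ)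
    (hSig : ∀ i j, Sig i j = ∫ ω, X ω i * X ω j ∂μ)
    (hSiginv : IsUnit Sig.det) (hBSB : IsUnit (B.transpose * Sig * B).det)
    -- σ-algebra generated by BᵀX
    (hm'le : MeasurableSpace.comap (fun ω => B.transpose.mulVec (X ω)) inferInstance ≤ mΩ)
    -- conditional independence  η ⟂ X | BᵀX
    (hCI : CondIndepFun
      (MeasurableSpace.comap (fun ω => B.transpose.mulVec (X ω)) inferInstance) hm'le η X μ)
    -- linearity condition E[X | BᵀX] = P_B(Σ)ᵀ X  with  P_B(Σ) = B (BᵀΣB)⁻¹ BᵀΣ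
    (hlin : ∀ j, μ[(fun ω => X ω j) |
        MeasurableSpace.comap (fun ω => B.transpose.mulVec (X ω)) inferInstance]
      =ᵐ[μ] fun ω => (B * (B.transpose * Sig * B)⁻¹ * B.transpose * Sig).transpose.mulVec (X ω) j)
    (m : ℝ → Fin p → ℂ)
    (hm : ∀ t j, m t j = ∫ ω, (X ω j : ℂ) * Complex.exp (Complex.I * t * η ω) ∂μ)
    (M : Matrix (Fin p) (Fin p) ℂ)
    (hM : ∀ i j, M i j = ∫ t, m t i * (starRingEnd ℂ) (m t j) ∂(μ.map η)) :
    (∀ t, m t ∈ Submodule.span ℂ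
        (Set.range fun k : Fin q => fun i : Fin p => ((Sig * B) i k : ℂ))) ∧
    (∀ j, (fun i => M i j) ∈ Submodule.span ℂ
        (Set.range fun k : Fin q => fun i : Fin p => ((Sig * B) i k : ℂ))) := by
  have hsym : Sig.transpose = Sig := by
    ext i j
    rw [Matrix.transpose_apply, hSig, hSig]
    simp only [mul_comm]
  set D := B.transpose * Sig * B with hD
  have hDs : D.transpose = D := by
    simp [hD, Matrix.transpose_mul, hsym, Matrix.mul_assoc]
  set C : Matrix (Fin q) (Fin p) ℝ := D⁻¹ * B.transpose with hC
  set L : Matrix (Fin p) (Fin p) ℝ := (Sig * B) * C with hL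
  have hP : (B * D⁻¹ * B.transpose * Sig).transpose = L := by
    simp [hL, hC, Matrix.transpose_mul, hsym, Matrix.mul_assoc, Matrix.transpose_nonsing_inv, hDs]
  have hLL : L * L = L := by
    have : C * (Sig * B) = 1 := by
      rw [hC, Matrix.mul_assoc, ← Matrix.mul_assoc B.transpose, ← hD, Matrix.nonsing_inv_mul _ hBSB]
    rw [hL, Matrix.mul_assoc, ← Matrix.mul_assoc C, this, Matrix.one_mul]
  rw [hP] at hlin
  have hXj : ∀ j, Measurable fun ω => X ω j := fun j => (measurable_pi_apply j).comp hXm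
  set E : ℝ → Ω → ℂ := fun t ω => Complex.exp (Complex.I * t * η ω) with hE
  have hEm : ∀ t, Measurable (E t) := fun t => by simp only [hE]; fun_prop
  have hEn : ∀ t ω, ‖E t ω‖ = 1 := fun t ω => by
    have : Complex.I * t * η ω = ((t * η ω : ℝ) : ℂ) * Complex.I := by push_cast; ring
    simp only [hE]
    rw [this, Complex.norm_exp_ofReal_mul_I]
  have hYi : ∀ j, Integrable (fun ω => L.mulVec (X ω) j) μ := fun j =>
    (integrable_congr (hlin j)).1 integrable_condExp
  -- m in terms of the projected vector
  have hm2 : ∀ t j, m t j = ∫ ω, ((L.mulVec (X ω) j : ℝ) : ℂ) * E t ω ∂μ := by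
    intro t j
    have hr : ∫ ω, ((L.mulVec (X ω) j : ℝ) : ℂ) * E t ω ∂μ
        = ∫ ω, (μ[(fun ω => X ω j) |
          MeasurableSpace.comap (fun ω => B.transpose.mulVec (X ω)) inferInstance]) ω • E t ω ∂μ := by
      refine integral_congr_ae ?_
      filter_upwards [hlin j] with ω hω
      rw [hω, Complex.real_smul]
    rw [hr, hm]
    by_cases hi : Integrable (fun ω => X ω j) μ
    · rw [← stmt2_key _ μ hm'le (fun ω => X ω j) (E t) (hXj j) (hEm t) hi
        (fun ω => (hEn t ω).le)]
      · simp only [Complex.real_smul, hE]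
      · have h1 : Measurable (fun x : Fin p → ℝ => x j) := measurable_pi_apply j
        have h2 : Measurable (fun y : ℝ => Complex.exp (Complex.I * t * y)) := by fun_prop
        exact hCI.symm.comp h1 h2
    · rw [condExp_of_not_integrable hi, integral_undef]
      · simp
      · intro h
        refine hi ((integrable_norm_iff (hXj j).aestronglyMeasurable).1 ?_)
        refine h.norm.congr (Filter.Eventually.of_forall fun ω => ?_)
        have := hEn t ω
        simp only [hE] at this
        simp only [norm_mul, this, mul_one, Complex.norm_real]
  have hYE : ∀ t j, Integrable (fun ω => ((L.mulVec (X ω) j : ℝ) : ℂ) * E t ω) μ := by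
    intro t j
    refine (hYi j).norm.mono' ((hYi j).ofReal.aestronglyMeasurable.mul
      (hEm t).aestronglyMeasurable) (Filter.Eventually.of_forall fun ω => ?_)
    rw [norm_mul, hEn, mul_one, Complex.norm_real]
  have hmL : ∀ t i, m t i = ∑ k, (L i k : ℂ) * m t k := by
    intro t i
    simp only [hm2]
    simp only [← integral_const_mul]
    rw [← integral_finsetSum _ (fun k _ => (hYE t k).const_mul _)]
    refine integral_congr_ae (Filter.Eventually.of_forall fun ω => ?_)
    have h0 : L.mulVec (X ω) i = ∑ k, L i k * L.mulVec (X ω) k := by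
      conv_lhs => rw [← hLL, ← Matrix.mulVec_mulVec]
      rfl
    simp only
    rw [h0, Complex.ofReal_sum, Finset.sum_mul]
    refine Finset.sum_congr rfl fun k _ => ?_
    push_cast
    ring
  refine ⟨fun t => stmt2_span (Sig * B) C (m t) (hmL t), fun j => ?_⟩
  have hmm : ∀ j, Measurable fun t => m t j := by
    intro j
    simp only [hm]
    refine StronglyMeasurable.measurable ?_
    refine StronglyMeasurable.integral_prod_right
      (f := fun t ω => (X ω j : ℂ) * Complex.exp (Complex.I * (t : ℝ) * η ω)) ?_
    refine Measurable.stronglyMeasurable ?_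
    simp only [Function.uncurry_def]
    have := hXj j
    fun_prop
  have hmb : ∀ j t, ‖m t j‖ ≤ ∫ ω, ‖X ω j‖ ∂μ := by
    intro j t
    rw [hm]
    refine (norm_integral_le_integral_norm _).trans (le_of_eq ?_)
    refine integral_congr_ae (Filter.Eventually.of_forall fun ω => ?_)
    have := hEn t ω
    simp only [hE] at this
    simp only [norm_mul, this, mul_one, Complex.norm_real]
  have : IsProbabilityMeasure (μ.map η) := Measure.isProbabilityMeasure_map hηm.aemeasurable
  have hint : ∀ k, Integrable (fun t => m t k * (starRingEnd ℂ) (m t j)) (μ.map η) := by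
    intro k
    refine Integrable.of_bound ?_ ((∫ ω, ‖X ω k‖ ∂μ) * (∫ ω, ‖X ω j‖ ∂μ))
      (Filter.Eventually.of_forall fun t => ?_)
    · exact ((hmm k).mul (Complex.continuous_conj.measurable.comp (hmm j))).aestronglyMeasurable
    · rw [norm_mul, RCLike.norm_conj]
      exact mul_le_mul (hmb k t) (hmb j t) (norm_nonneg _) ((norm_nonneg _).trans (hmb k t))
  refine stmt2_span (Sig * B) C _ fun i => ?_
  simp only [hM]
  simp only [← integral_const_mul]
  rw [← integral_finsetSum _ (fun k _ => (hint k).const_mul _)]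
  refine integral_congr_ae (Filter.Eventually.of_forall fun t => ?_)
  simp only
  conv_lhs => rw [hmL t i, Finset.sum_mul]
  exact Finset.sum_congr rfl fun k _ => by rw [mul_assoc]
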